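/- Let B = 2. Consider an instance of jobs with positive integer lengths and arbitrary feasible slot sets in which an integral schedule exists. Then the minimum active time over all integral schedules is at most 4/3 times the minimum fractional active time over all fractional (preemptive) schedules. -/

import Mathlib

open Finset

/-- An integral schedule: each job `j` is assigned a set `A j ⊆ T j` of slots
with `(A j).card = len j`, and every slot is used by at most `B` jobs. -/
def IsIntegralSchedule {J S : Type*} [Fintype J] [DecidableEq S]
    (B : ℕ) (T : J → Finset S) (len : J → ℕ) (A : J → Finset S) : Prop :=
  (∀ j, A j ⊆ T j) ∧ (∀ j, (A j).card = len j) ∧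
    ∀ s : S, (Finset.univ.filter (fun j => s ∈ A j)).card ≤ B

/-- The active time of an integral schedule: the number of slots used by some job. -/
def activeTime {J S : Type*} [Fintype J] [DecidableEq S] (A : J → Finset S) : ℕ :=
  (Finset.univ.biUnion A).card

/-- A fractional (preemptive) schedule. -/
def IsFracSchedule {J S : Type*} [Fintype J] [Fintype S]
    (B : ℕ) (T : J → Finset S) (len : J → ℕ) (x : J → S → ℝ) (a : S → ℝ) : Prop :=
  (∀ j s, 0 ≤ x j s) ∧ (∀ s, 0 ≤ a s ∧ a s ≤ 1) ∧
    (∀ j s, s ∉ T j → x j s = 0) ∧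
    (∀ j, ∑ s, x j s = (len j : ℝ)) ∧
    (∀ j s, x j s ≤ a s) ∧
    (∀ s, ∑ j, x j s ≤ (B : ℝ) * a s)


lemma at_finish {J : Type*} [Fintype J] (n : J → ℤ) (L f : J → ℝ) (D : ℝ)
    (hL : ∀ j, 0 ≤ L j) (hf : ∀ j, |L j - n j| ≤ f j) (hodd : Odd (∑ j, n j))
    (hD0 : 0 ≤ D) (hD : ∀ i, 2 * L i - ∑ j, L j ≤ D) :
    3 * (1 - (∑ j, f j + D)) ≤ ∑ j, L j := by
  classical
  have hf0 : ∀ j, 0 ≤ f j := fun j => (abs_nonneg _).trans (hf j)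
  have hLs : 0 ≤ ∑ j, L j := Finset.sum_nonneg fun j _ => hL j
  by_cases h1 : 1 ≤ ∑ j, f j + D
  · linarith
  push Not at h1
  have hfs : ∑ j, f j < 1 := by linarith
  have hfj : ∀ j, f j < 1 := fun j =>
    (Finset.single_le_sum (fun i _ => hf0 i) (Finset.mem_univ j)).trans_lt hfs
  have hn : ∀ j, 0 ≤ n j := by
    intro j
    have h2 := abs_le.1 (hf j)
    have : (-1 : ℝ) < n j := by linarith [hL j, hfj j]
    have : (-1 : ℤ) < n j := by exact_mod_cast this
    omega
  have hsum : ∑ j, (n j : ℝ) - ∑ j, f j ≤ ∑ j, L j := by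
    rw [← Finset.sum_sub_distrib]
    exact Finset.sum_le_sum fun j _ => by linarith [(abs_le.1 (hf j)).1]
  have hf00 : 0 ≤ ∑ j, f j := Finset.sum_nonneg fun j _ => hf0 j
  by_cases h3 : 3 ≤ ∑ j, n j
  · have : (3 : ℝ) ≤ ∑ j, (n j : ℝ) := by exact_mod_cast h3
    linarith
  have hs0 : 0 ≤ ∑ j, n j := Finset.sum_nonneg fun j _ => hn j
  have hs1 : ∑ j, n j = 1 := by
    obtain ⟨k, hk⟩ := hodd
    omega
  obtain ⟨i, hi⟩ : ∃ i, n i ≠ 0 := by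
    by_contra hcon
    push Not at hcon
    simp [hcon] at hs1
  have hi1 : 1 ≤ n i := by have := hn i; omega
  have hrest : ∑ j ∈ univ.erase i, n j = 1 - n i := by
    rw [← hs1, ← Finset.add_sum_erase univ n (Finset.mem_univ i)]; ring
  have hLr : ∑ j ∈ univ.erase i, L j ≤ ∑ j ∈ univ.erase i, (n j : ℝ) + ∑ j ∈ univ.erase i, f j := by
    rw [← Finset.sum_add_distrib]
    exact Finset.sum_le_sum fun j _ => by linarith [(abs_le.1 (hf j)).2]
  have e1 := Finset.add_sum_erase univ L (Finset.mem_univ i)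
  have e2 := Finset.add_sum_erase univ f (Finset.mem_univ i)
  have hrest' : ∑ j ∈ univ.erase i, (n j : ℝ) = 1 - n i := by exact_mod_cast hrest
  have hi1' : (1 : ℝ) ≤ n i := by exact_mod_cast hi1
  have := hD i
  have := (abs_le.1 (hf i)).1
  linarith

/-- cut weight of a vertex set given by 0/1 indicators -/
noncomputable def atCut {J S : Type*} [Fintype J] [Fintype S] (m : J → ℕ) (x : J → S → ℝ)
    (a : S → ℝ) (cp : J → S → ℤ) (ck : ∀ j, Fin (m j) → ℤ) (cs : S → Bool → ℤ) : ℝ :=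
  (∑ j, ∑ s, ∑ b, x j s / 2 * |((cp j s - cs s b : ℤ) : ℝ)|)
  + (∑ j, ∑ s, ∑ k, (1 - x j s) / m j * |((cp j s - ck j k : ℤ) : ℝ)|)
  + ∑ s, (1 - a s) * |((cs s true - cs s false : ℤ) : ℝ)|

noncomputable def atDef {J S : Type*} [Fintype J] [Fintype S] (x : J → S → ℝ)
    (a : S → ℝ) (cs : S → Bool → ℤ) : ℝ :=
  ∑ s, ∑ b, (cs s b : ℝ) * (a s - (∑ j, x j s) / 2)

noncomputable def atLoad {J S : Type*} [Fintype J] [Fintype S] (x : J → S → ℝ)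
    (cs : S → Bool → ℤ) : ℝ :=
  ∑ s, ∑ b, (cs s b : ℝ) * ((∑ j, x j s) / 2)

lemma at_abs_split {p u v : ℤ} (hp : p = 0 ∨ p = 1) (hu : u = 0 ∨ u = 1) (hv : v = 0 ∨ v = 1)
    (h : u ≠ v) : |((p - u : ℤ) : ℝ)| + |((p - v : ℤ) : ℝ)| = 1 := by
  rcases hp with rfl | rfl <;> rcases hu with rfl | rfl <;> rcases hv with rfl | rfl <;> simp_all

lemma at_odd_set {J S : Type*} [Fintype J] [Fintype S] (m : J → ℕ) (x : J → S → ℝ)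
    (a : S → ℝ) (hx0 : ∀ j s, 0 ≤ x j s) (ha1 : ∀ s, a s ≤ 1) (hxa : ∀ j s, x j s ≤ a s)
    (hcap : ∀ s, ∑ j, x j s ≤ 2 * a s) (hm : ∀ j, ∑ s, (1 - x j s) = m j)
    (cp : J → S → ℤ) (ck : ∀ j, Fin (m j) → ℤ) (cs : S → Bool → ℤ)
    (hcp : ∀ j s, cp j s = 0 ∨ cp j s = 1) (hck : ∀ j k, ck j k = 0 ∨ ck j k = 1)
    (hcs : ∀ s b, cs s b = 0 ∨ cs s b = 1)
    (hodd : Odd (∑ j, ∑ s, cp j s + ∑ j, ∑ k, ck j k + ∑ s, ∑ b, cs s b)) :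
    3 * (1 - (atCut m x a cp ck cs + atDef x a cs)) ≤ atLoad x cs := by
  classical
  have hx1 : ∀ j s, x j s ≤ 1 := fun j s => (hxa j s).trans (ha1 s)
  have hcsn : ∀ s b, (0 : ℝ) ≤ cs s b := by
    intro s b; rcases hcs s b with h | h <;> simp [h]
  have hload0 : 0 ≤ atLoad x cs := by
    unfold atLoad
    exact Finset.sum_nonneg fun s _ => Finset.sum_nonneg fun b _ =>
      mul_nonneg (hcsn s b) (div_nonneg (Finset.sum_nonneg fun j _ => hx0 j s) (by norm_num))
  have hd0 : ∀ s, 0 ≤ ∑ b, (cs s b : ℝ) * (a s - (∑ j, x j s) / 2) := fun s =>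
    Finset.sum_nonneg fun b _ => mul_nonneg (hcsn s b) (by linarith [hcap s])
  have hdef0 : 0 ≤ atDef x a cs := Finset.sum_nonneg fun s _ => hd0 s
  have t1 : ∀ j s, 0 ≤ ∑ b, x j s / 2 * |((cp j s - cs s b : ℤ) : ℝ)| := fun j s =>
    Finset.sum_nonneg fun b _ => mul_nonneg (by linarith [hx0 j s]) (abs_nonneg _)
  have t2' : ∀ j s k, 0 ≤ (1 - x j s) / m j * |((cp j s - ck j k : ℤ) : ℝ)| := fun j s k =>
    mul_nonneg (div_nonneg (by linarith [hx1 j s]) (Nat.cast_nonneg _)) (abs_nonneg _)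
  have t2 : ∀ j s, 0 ≤ ∑ k, (1 - x j s) / m j * |((cp j s - ck j k : ℤ) : ℝ)| := fun j s =>
    Finset.sum_nonneg fun k _ => t2' j s k
  have t3 : ∀ s, 0 ≤ (1 - a s) * |((cs s true - cs s false : ℤ) : ℝ)| := fun s =>
    mul_nonneg (by linarith [ha1 s]) (abs_nonneg _)
  have T1 : 0 ≤ ∑ j, ∑ s, ∑ b, x j s / 2 * |((cp j s - cs s b : ℤ) : ℝ)| :=
    Finset.sum_nonneg fun j _ => Finset.sum_nonneg fun s _ => t1 j s
  have T2 : 0 ≤ ∑ j, ∑ s, ∑ k, (1 - x j s) / m j * |((cp j s - ck j k : ℤ) : ℝ)| :=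
    Finset.sum_nonneg fun j _ => Finset.sum_nonneg fun s _ => t2 j s
  have T3 : 0 ≤ ∑ s, (1 - a s) * |((cs s true - cs s false : ℤ) : ℝ)| :=
    Finset.sum_nonneg fun s _ => t3 s
  by_cases hS : ∃ s, cs s true ≠ cs s false
  · obtain ⟨s, hs⟩ := hS
    have e1 : (∑ j, x j s) / 2 ≤ ∑ j, ∑ s, ∑ b, x j s / 2 * |((cp j s - cs s b : ℤ) : ℝ)| := by
      rw [Finset.sum_div]
      refine Finset.sum_le_sum fun j _ => ?_
      refine le_trans ?_ (Finset.single_le_sum (fun s _ => t1 j s) (Finset.mem_univ s))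
      rw [Fintype.sum_bool, ← mul_add, at_abs_split (hcp j s) (hcs s true) (hcs s false) hs, mul_one]
    have e3 : 1 - a s ≤ ∑ s, (1 - a s) * |((cs s true - cs s false : ℤ) : ℝ)| := by
      refine le_trans ?_ (Finset.single_le_sum (fun s _ => t3 s) (Finset.mem_univ s))
      rcases hcs s true with h | h <;> rcases hcs s false with h' | h' <;>
        first
          | exact absurd (h.trans h'.symm) hs
          | (rw [h, h']; norm_num)
    have e4 : a s - (∑ j, x j s) / 2 ≤ atDef x a cs := by
      refine le_trans ?_ (Finset.single_le_sum (fun s _ => hd0 s) (Finset.mem_univ s))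
      rw [Fintype.sum_bool]
      rcases hcs s true with h | h <;> rcases hcs s false with h' | h' <;>
        first
          | exact absurd (h.trans h'.symm) hs
          | (rw [h, h']; norm_num)
    have : 1 ≤ atCut m x a cp ck cs + atDef x a cs := by unfold atCut; linarith
    linarith
  by_cases hK : ∃ j k k', ck j k ≠ ck j k'
  · obtain ⟨j, k, k', hk⟩ := hK
    have hkk : k ≠ k' := fun h => hk (by rw [h])
    have hmpos : (0 : ℝ) < m j := by
      have := k.pos
      exact_mod_cast this
    have e2 : 1 ≤ ∑ j, ∑ s, ∑ k, (1 - x j s) / m j * |((cp j s - ck j k : ℤ) : ℝ)| := by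
      refine le_trans ?_ (Finset.single_le_sum
        (fun j _ => Finset.sum_nonneg fun s _ => t2 j s) (Finset.mem_univ j))
      have : (1 : ℝ) = ∑ s, (1 - x j s) / m j := by
        rw [← Finset.sum_div, hm j, div_self hmpos.ne']
      refine le_trans (le_of_eq this) ?_
      refine Finset.sum_le_sum fun s _ => ?_
      refine le_trans ?_ (Finset.sum_le_univ_sum_of_nonneg (s := {k, k'}) (fun k => t2' j s k))
      rw [Finset.sum_pair hkk, ← mul_add, at_abs_split (hcp j s) (hck j k) (hck j k') hk, mul_one]
    have : 1 ≤ atCut m x a cp ck cs + atDef x a cs := by unfold atCut; linarith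
    linarith
  push Not at hS hK
  set r : S → ℤ := fun s => cs s true with hr
  have hcsr : ∀ s b, cs s b = r s := by
    intro s b; cases b
    · exact (hS s).symm
    · rfl
  obtain ⟨κ, hκ, hκ01⟩ : ∃ κ : J → ℤ, (∀ j k, ck j k = κ j) ∧ ∀ j, κ j = 0 ∨ κ j = 1 := by
    refine ⟨fun j => if h : 0 < m j then ck j ⟨0, h⟩ else 0, ?_, ?_⟩
    · intro j k
      have : 0 < m j := k.pos
      simp only [this, dif_pos]
      exact hK j _ _
    · intro j
      by_cases h : 0 < m j
      · simp only [h, dif_pos]; exact hck _ _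
      · simp [h]
  have hr0 : ∀ s, (0 : ℝ) ≤ r s := fun s => hcsn s true
  have hLoad : atLoad x cs = ∑ j, ∑ s, x j s * r s := by
    unfold atLoad
    rw [Finset.sum_comm (s := (univ : Finset J))]
    refine Finset.sum_congr rfl fun s _ => ?_
    rw [Fintype.sum_bool, hcsr, hcsr, ← Finset.sum_mul]; ring
  have hDef : atDef x a cs = ∑ s, r s * (2 * a s - ∑ j, x j s) := by
    unfold atDef
    refine Finset.sum_congr rfl fun s _ => ?_
    rw [Fintype.sum_bool, hcsr, hcsr]; ring
  have hCut : ∑ j, (∑ s, (x j s * |((cp j s - r s : ℤ) : ℝ)| + (1 - x j s) * |((cp j s - κ j : ℤ) : ℝ)|))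
      ≤ atCut m x a cp ck cs := by
    unfold atCut
    refine le_trans (le_of_eq ?_) (le_add_of_nonneg_right T3)
    rw [← Finset.sum_add_distrib]
    refine Finset.sum_congr rfl fun j _ => ?_
    rw [← Finset.sum_add_distrib]
    refine Finset.sum_congr rfl fun s _ => ?_
    congr 1
    · rw [Fintype.sum_bool, hcsr, hcsr]; ring
    · simp only [hκ, Finset.sum_const, Finset.card_univ, Fintype.card_fin, nsmul_eq_mul]
      by_cases h : m j = 0
      · have h0 : ∑ s, (1 - x j s) = 0 := by rw [hm j, h]; simp
        have := (Finset.sum_eq_zero_iff_of_nonneg (fun s _ => by linarith [hx1 j s])).1 h0 s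
          (Finset.mem_univ s)
        simp [this]
      · have : (m j : ℝ) ≠ 0 := by exact_mod_cast h
        field_simp
  have key := at_finish (fun j => ∑ s, cp j s - κ j * m j) (fun j => ∑ s, x j s * r s)
    (fun j => ∑ s, (x j s * |((cp j s - r s : ℤ) : ℝ)| + (1 - x j s) * |((cp j s - κ j : ℤ) : ℝ)|))
    (atDef x a cs) (fun j => Finset.sum_nonneg fun s _ => mul_nonneg (hx0 j s) (hr0 s))
    ?_ ?_ hdef0 ?_
  · rw [hLoad]; linarith
  · intro j
    have : ∑ s, x j s * (r s : ℝ) - ((∑ s, cp j s - κ j * m j : ℤ) : ℝ)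
        = ∑ s, (x j s * (-((cp j s - r s : ℤ) : ℝ)) + (1 - x j s) * (-((cp j s - κ j : ℤ) : ℝ))) := by
      push_cast
      rw [← hm j, Finset.mul_sum, ← Finset.sum_sub_distrib, ← Finset.sum_sub_distrib]
      exact Finset.sum_congr rfl fun s _ => by ring
    rw [this]
    refine (Finset.abs_sum_le_sum_abs _ _).trans (Finset.sum_le_sum fun s _ => ?_)
    refine (abs_add_le _ _).trans (le_of_eq ?_)
    rw [abs_mul, abs_mul, abs_neg, abs_neg, abs_of_nonneg (hx0 j s),
      abs_of_nonneg (by linarith [hx1 j s] : 0 ≤ 1 - x j s)]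
  · have e1 : ∑ j, ∑ k, ck j k = ∑ j, κ j * m j :=
      Finset.sum_congr rfl fun j _ => by simp [hκ, mul_comm]
    have e2 : ∑ s, ∑ b, cs s b = 2 * ∑ s, r s := by
      rw [Finset.mul_sum]
      exact Finset.sum_congr rfl fun s _ => by rw [Fintype.sum_bool, hcsr, hcsr]; ring
    rw [e1, e2] at hodd
    rw [Finset.sum_sub_distrib]
    obtain ⟨q, hq⟩ := hodd
    exact ⟨q - ∑ j, κ j * m j - ∑ s, r s, by linarith⟩
  · intro i
    rw [hDef, Finset.sum_comm (s := (univ : Finset J)), Finset.mul_sum, ← Finset.sum_sub_distrib]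
    refine Finset.sum_le_sum fun s _ => ?_
    rw [← Finset.sum_mul]
    nlinarith [hxa i s, hr0 s, mul_nonneg (hr0 s) (sub_nonneg.2 (hxa i s))]

lemma at_tutte {V : Type*} [Fintype V] [DecidableEq V] (G : SimpleGraph V)
    (heven : Even (Fintype.card V)) (h : ¬ ∃ M : G.Subgraph, M.IsPerfectMatching) :
    ∃ (U : Finset V) (F : Finset (Finset V)), (∀ C ∈ F, Odd C.card) ∧
      (∀ C ∈ F, ∀ v ∈ C, v ∉ U) ∧
      (∀ C ∈ F, ∀ D ∈ F, ∀ v, v ∈ C → v ∈ D → C = D) ∧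
      (∀ C ∈ F, ∀ v ∈ C, ∀ w, G.Adj v w → w ∉ U → w ∈ C) ∧ U.card + 2 ≤ F.card := by
  classical
  rw [SimpleGraph.tutte] at h
  push Not at h
  obtain ⟨u, hu⟩ := h
  unfold SimpleGraph.IsTutteViolator at hu
  set H := ((⊤ : G.Subgraph).deleteVerts u).coe with hH
  have hverts : ∀ v, v ∈ ((⊤ : G.Subgraph).deleteVerts u).verts ↔ v ∉ u := by
    intro v; simp
  have hadj : ∀ v w : ((⊤ : G.Subgraph).deleteVerts u).verts, G.Adj v w → H.Adj v w := by
    intro v w hvw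
    have h1 := (hverts v).1 v.2
    have h2 := (hverts w).1 w.2
    simp [hH, h1, h2, hvw]
  let φ : H.ConnectedComponent → Finset V := fun c => (Subtype.val '' c.supp).toFinset
  have hφ : ∀ c v, v ∈ φ c ↔ ∃ hv : v ∈ ((⊤ : G.Subgraph).deleteVerts u).verts,
      H.connectedComponentMk ⟨v, hv⟩ = c := by
    intro c v
    simp only [φ, Set.mem_toFinset, Set.mem_image]
    constructor
    · rintro ⟨w, hw, rfl⟩
      exact ⟨w.2, hw⟩
    · rintro ⟨hv, h⟩
      exact ⟨⟨v, hv⟩, h, rfl⟩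
  have hcommon : ∀ c d v, v ∈ φ c → v ∈ φ d → c = d := by
    intro c d v hc hd
    obtain ⟨h1, h2⟩ := (hφ c v).1 hc
    obtain ⟨h3, h4⟩ := (hφ d v).1 hd
    exact h2.symm.trans h4
  have hinj : Function.Injective φ := by
    intro c d hcd
    obtain ⟨v, hv⟩ := c.nonempty_supp
    have h1 : (v : V) ∈ φ c := (hφ c v).2 ⟨v.2, hv⟩
    exact hcommon c d v h1 (hcd ▸ h1)
  refine ⟨u.toFinset, H.oddComponents.toFinset.image φ, ?_, ?_, ?_, ?_, ?_⟩
  · intro C hC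
    obtain ⟨c, hc, rfl⟩ := Finset.mem_image.1 hC
    rw [Set.mem_toFinset] at hc
    have hc' : Odd c.supp.ncard := hc
    have : (φ c).card = c.supp.ncard := by
      simp only [φ]
      rw [← Set.ncard_eq_toFinset_card', Set.ncard_image_of_injective _ Subtype.val_injective]
    rw [this]; exact hc'
  · intro C hC v hv
    obtain ⟨c, hc, rfl⟩ := Finset.mem_image.1 hC
    obtain ⟨h1, h2⟩ := (hφ c v).1 hv
    rw [Set.mem_toFinset]
    exact (hverts v).1 h1
  · intro C hC D hD v hv hv'
    obtain ⟨c, hc, rfl⟩ := Finset.mem_image.1 hC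
    obtain ⟨d, hd, rfl⟩ := Finset.mem_image.1 hD
    rw [hcommon c d v hv hv']
  · intro C hC v hv w hvw hw
    obtain ⟨c, hc, rfl⟩ := Finset.mem_image.1 hC
    obtain ⟨h1, h2⟩ := (hφ c v).1 hv
    rw [Set.mem_toFinset] at hw
    refine (hφ c w).2 ⟨(hverts w).2 hw, ?_⟩
    rw [← h2]
    exact (SimpleGraph.ConnectedComponent.sound (hadj ⟨v, h1⟩ ⟨w, (hverts w).2 hw⟩ hvw).reachable).symm
  · rw [Finset.card_image_of_injective _ hinj]
    have e1 : H.oddComponents.toFinset.card = H.oddComponents.ncard :=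
      (Set.ncard_eq_toFinset_card' _).symm
    have e2 : u.toFinset.card = u.ncard := (Set.ncard_eq_toFinset_card' _).symm
    rw [e1, e2]
    have hpar := SimpleGraph.odd_ncard_oddComponents (G := H)
    have hcard : Nat.card ((⊤ : G.Subgraph).deleteVerts u).verts + u.ncard = Fintype.card V := by
      rw [Nat.card_coe_set_eq]
      have : ((⊤ : G.Subgraph).deleteVerts u).verts = uᶜ := by ext v; simp
      rw [this, add_comm, Set.ncard_add_ncard_compl, Nat.card_eq_fintype_card]
    rw [← hcard] at heven
    by_contra hcon
    have hlt : H.oddComponents.ncard = u.ncard + 1 := by omega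
    rw [hlt] at hpar
    rw [Nat.even_add] at heven
    rw [Nat.odd_add_one, ← Nat.not_even_iff_odd, ← Nat.not_even_iff_odd] at hpar
    tauto

/-- vertices of the matching gadget: job/slot pairs, slack vertices, two copies of every slot,
and dummies -/
abbrev AtV (J S : Type*) (m : J → ℕ) (d : ℕ) := (J × S) ⊕ (Σ j, Fin (m j)) ⊕ (S × Bool) ⊕ Fin d

abbrev atP {J S : Type*} {m : J → ℕ} {d : ℕ} (j : J) (s : S) : AtV J S m d := Sum.inl (j, s)
abbrev atK {J S : Type*} {m : J → ℕ} {d : ℕ} (j : J) (k : Fin (m j)) : AtV J S m d :=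
  Sum.inr (Sum.inl ⟨j, k⟩)
abbrev atS {J S : Type*} {m : J → ℕ} {d : ℕ} (s : S) (b : Bool) : AtV J S m d :=
  Sum.inr (Sum.inr (Sum.inl (s, b)))
abbrev atD {J S : Type*} {m : J → ℕ} {d : ℕ} (i : Fin d) : AtV J S m d :=
  Sum.inr (Sum.inr (Sum.inr i))

def atR {J S : Type*} (T : J → Finset S) (m : J → ℕ) (d : ℕ) : AtV J S m d → AtV J S m d → Prop
  | Sum.inl p, Sum.inr (Sum.inl q) => p.1 = q.1
  | Sum.inl p, Sum.inr (Sum.inr (Sum.inl q)) => p.2 = q.1 ∧ p.2 ∈ T p.1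
  | Sum.inr (Sum.inr (Sum.inl p)), Sum.inr (Sum.inr (Sum.inl q)) => p.1 = q.1
  | Sum.inr (Sum.inr (Sum.inl _)), Sum.inr (Sum.inr (Sum.inr _)) => True
  | Sum.inr (Sum.inr (Sum.inr _)), Sum.inr (Sum.inr (Sum.inr _)) => True
  | _, _ => False

def atG {J S : Type*} (T : J → Finset S) (m : J → ℕ) (d : ℕ) : SimpleGraph (AtV J S m d) :=
  SimpleGraph.fromRel (atR T m d)

lemma atG_PK {J S : Type*} (T : J → Finset S) (m : J → ℕ) (d : ℕ) (j : J) (s : S)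
    (k : Fin (m j)) : (atG T m d).Adj (atP j s) (atK j k) := by
  simp [atG, atR]

lemma atG_PS {J S : Type*} (T : J → Finset S) (m : J → ℕ) (d : ℕ) (j : J) (s : S)
    (b : Bool) (h : s ∈ T j) : (atG T m d).Adj (atP j s) (atS s b) := by
  simp [atG, atR, h]

lemma atG_SS {J S : Type*} (T : J → Finset S) (m : J → ℕ) (d : ℕ) (s : S) :
    (atG T m d).Adj (atS s true) (atS s false) := by
  simp [atG, atR]

lemma atG_SD {J S : Type*} (T : J → Finset S) (m : J → ℕ) (d : ℕ) (s : S) (b : Bool)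
    (i : Fin d) : (atG T m d).Adj (atS s b) (atD i) := by
  simp [atG, atR]

lemma atG_DD {J S : Type*} (T : J → Finset S) (m : J → ℕ) (d : ℕ)
    (i i' : Fin d) (h : i ≠ i') : (atG T m d).Adj (atD i) (atD i') := by
  simp [atG, atR, h]

/-- integer indicator -/
def atInd {V : Type*} [DecidableEq V] (C : Finset V) (v : V) : ℤ := if v ∈ C then 1 else 0

lemma atInd_01 {V : Type*} [DecidableEq V] (C : Finset V) (v : V) :
    atInd C v = 0 ∨ atInd C v = 1 := by
  unfold atInd; split_ifs <;> simp

lemma atInd_nonneg {V : Type*} [DecidableEq V] (C : Finset V) (v : V) :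
    (0 : ℝ) ≤ (atInd C v : ℝ) := by
  unfold atInd; split_ifs <;> simp

lemma atInd_card {J S : Type*} [Fintype J] [Fintype S] (m : J → ℕ) (d : ℕ)
    [DecidableEq (AtV J S m d)] (C : Finset (AtV J S m d)) :
    (C.card : ℤ) = ∑ j, ∑ s, atInd C (atP j s) + ∑ j, ∑ k, atInd C (atK j k)
      + ∑ s, ∑ b, atInd C (atS s b) + ∑ i, atInd C (atD i) := by
  have : (C.card : ℤ) = ∑ v, atInd C v := by
    unfold atInd
    simp
  rw [this, Fintype.sum_sum_type, Fintype.sum_sum_type, Fintype.sum_sum_type,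
    Fintype.sum_prod_type, Fintype.sum_sigma, Fintype.sum_prod_type]
  ring

lemma at_sum_ind {V : Type*} [DecidableEq V] (F : Finset (Finset V))
    (hF : ∀ C ∈ F, ∀ D ∈ F, ∀ v, v ∈ C → v ∈ D → C = D) (v : V) :
    ∑ C ∈ F, (atInd C v : ℝ) ≤ 1 := by
  have : ∑ C ∈ F, (atInd C v : ℝ) = ((F.filter (fun C => v ∈ C)).card : ℝ) := by
    unfold atInd
    rw [Finset.card_filter]
    push_cast
    rfl
  rw [this]
  have : (F.filter (fun C => v ∈ C)).card ≤ 1 := by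
    rw [Finset.card_le_one]
    intro C hC D hD
    rw [Finset.mem_filter] at hC hD
    exact hF C hC.1 D hD.1 v hC.2 hD.2
  exact_mod_cast this

lemma at_sum_edge {V : Type*} [DecidableEq V] (G : SimpleGraph V) (U : Finset V)
    (F : Finset (Finset V))
    (hF : ∀ C ∈ F, ∀ D ∈ F, ∀ v, v ∈ C → v ∈ D → C = D)
    (hcl : ∀ C ∈ F, ∀ v ∈ C, ∀ w, G.Adj v w → w ∉ U → w ∈ C) (v w : V) (h : G.Adj v w) :
    ∑ C ∈ F, |((atInd C v - atInd C w : ℤ) : ℝ)| ≤ (atInd U v : ℝ) + atInd U w := by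
  have h1 : ∀ C ∈ F, |((atInd C v - atInd C w : ℤ) : ℝ)| ≤
      (atInd C v : ℝ) * atInd U w + (atInd C w : ℝ) * atInd U v := by
    intro C hC
    have hvw := hcl C hC v
    have hwv := hcl C hC w
    by_cases hv : v ∈ C <;> by_cases hw : w ∈ C <;> by_cases hu : v ∈ U <;>
      by_cases hu' : w ∈ U <;> simp [atInd, hv, hw, hu, hu']
    · exact (hw (hvw hv w h hu')).elim
    · exact (hw (hvw hv w h hu')).elim
    · exact (hv (hwv hw v h.symm hu)).elim
    · exact (hv (hwv hw v h.symm hu)).elim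
  refine (Finset.sum_le_sum h1).trans ?_
  rw [Finset.sum_add_distrib, ← Finset.sum_mul, ← Finset.sum_mul]
  nlinarith [at_sum_ind F hF v, at_sum_ind F hF w, atInd_nonneg U v, atInd_nonneg U w,
    mul_nonneg (atInd_nonneg U v) (sub_nonneg.2 (at_sum_ind F hF w)),
    mul_nonneg (atInd_nonneg U w) (sub_nonneg.2 (at_sum_ind F hF v))]

lemma at_deg {J S : Type*} [Fintype J] [Fintype S] (m : J → ℕ) (x : J → S → ℝ)
    (a : S → ℝ) (hx1 : ∀ j s, x j s ≤ 1)
    (hcap : ∀ s, ∑ j, x j s ≤ 2 * a s) (hm : ∀ j, ∑ s, (1 - x j s) = m j)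
    (up : J → S → ℝ) (uk : ∀ j, Fin (m j) → ℝ) (us : S → Bool → ℝ)
    (hup : ∀ j s, 0 ≤ up j s) (hus : ∀ s b, 0 ≤ us s b) :
    (∑ j, ∑ s, ∑ b, x j s / 2 * (up j s + us s b))
    + (∑ j, ∑ s, ∑ k, (1 - x j s) / m j * (up j s + uk j k))
    + ∑ s, (1 - a s) * (us s true + us s false)
    ≤ ∑ j, ∑ s, up j s + ∑ j, ∑ k, uk j k + ∑ s, ∑ b, us s b := by
  have e1 : (∑ j, ∑ s, ∑ b, x j s / 2 * (up j s + us s b))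
      = ∑ j, ∑ s, x j s * up j s + ∑ s, (∑ j, x j s) / 2 * (us s true + us s false) := by
    have : ∑ s, (∑ j, x j s) / 2 * (us s true + us s false)
        = ∑ j, ∑ s, x j s / 2 * (us s true + us s false) := by
      rw [Finset.sum_comm]
      refine Finset.sum_congr rfl fun s _ => ?_
      rw [Finset.sum_div, Finset.sum_mul]
    rw [this, ← Finset.sum_add_distrib]
    refine Finset.sum_congr rfl fun j _ => ?_
    rw [← Finset.sum_add_distrib]
    refine Finset.sum_congr rfl fun s _ => ?_
    rw [Fintype.sum_bool]; ring
  have e2 : (∑ j, ∑ s, ∑ k, (1 - x j s) / m j * (up j s + uk j k))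
      ≤ ∑ j, ∑ s, (1 - x j s) * up j s + ∑ j, ∑ k, uk j k := by
    rw [← Finset.sum_add_distrib]
    refine Finset.sum_le_sum fun j _ => ?_
    by_cases h : m j = 0
    · have : IsEmpty (Fin (m j)) := by rw [h]; infer_instance
      simp only [Finset.univ_eq_empty, Finset.sum_empty, Finset.sum_const_zero, add_zero]
      exact Finset.sum_nonneg fun s _ => mul_nonneg (by linarith [hx1 j s]) (hup j s)
    · have hm0 : (m j : ℝ) ≠ 0 := by exact_mod_cast h
      have : ∑ k, uk j k = ∑ s, ∑ k, (1 - x j s) / m j * uk j k := by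
        rw [Finset.sum_comm]
        refine Finset.sum_congr rfl fun k _ => ?_
        rw [← Finset.sum_mul, ← Finset.sum_div, hm j, div_self hm0, one_mul]
      rw [this, ← Finset.sum_add_distrib]
      refine le_of_eq (Finset.sum_congr rfl fun s _ => ?_)
      simp only [mul_add, Finset.sum_add_distrib, Finset.sum_const, Finset.card_univ,
        Fintype.card_fin, nsmul_eq_mul]
      congr 1
      field_simp
  have e3 : ∑ j, ∑ s, x j s * up j s + ∑ j, ∑ s, (1 - x j s) * up j s = ∑ j, ∑ s, up j s := by
    rw [← Finset.sum_add_distrib]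
    refine Finset.sum_congr rfl fun j _ => ?_
    rw [← Finset.sum_add_distrib]
    exact Finset.sum_congr rfl fun s _ => by ring
  have e4 : ∑ s, (∑ j, x j s) / 2 * (us s true + us s false)
      + ∑ s, (1 - a s) * (us s true + us s false) ≤ ∑ s, ∑ b, us s b := by
    rw [← Finset.sum_add_distrib]
    refine Finset.sum_le_sum fun s _ => ?_
    rw [Fintype.sum_bool]
    nlinarith [hcap s, hus s true, hus s false,
      mul_nonneg (sub_nonneg.2 (hcap s)) (add_nonneg (hus s true) (hus s false))]
  linarith

noncomputable abbrev atCutC {J S : Type*} [Fintype J] [Fintype S] {m : J → ℕ} {d : ℕ}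
    [DecidableEq (AtV J S m d)] (x : J → S → ℝ) (a : S → ℝ) (C : Finset (AtV J S m d)) : ℝ :=
  atCut m x a (fun j s => atInd C (atP j s)) (fun j k => atInd C (atK j k))
    (fun s b => atInd C (atS s b))

lemma at_sum_cut {J S : Type*} [Fintype J] [Fintype S] (T : J → Finset S) (m : J → ℕ) (d : ℕ)
    [DecidableEq (AtV J S m d)] (x : J → S → ℝ)
    (a : S → ℝ) (hx0 : ∀ j s, 0 ≤ x j s) (hxT : ∀ j s, s ∉ T j → x j s = 0)
    (hx1 : ∀ j s, x j s ≤ 1) (ha1 : ∀ s, a s ≤ 1)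
    (hcap : ∀ s, ∑ j, x j s ≤ 2 * a s) (hm : ∀ j, ∑ s, (1 - x j s) = m j)
    (U : Finset (AtV J S m d)) (F : Finset (Finset (AtV J S m d)))
    (hF : ∀ C ∈ F, ∀ D ∈ F, ∀ v, v ∈ C → v ∈ D → C = D)
    (hcl : ∀ C ∈ F, ∀ v ∈ C, ∀ w, (atG T m d).Adj v w → w ∉ U → w ∈ C) :
    ∑ C ∈ F, atCutC x a C ≤ (U.card : ℝ) - ∑ i, (atInd U (atD i) : ℝ) := by
  have hE := at_sum_edge (atG T m d) U F hF hcl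
  have hU : (U.card : ℝ) - ∑ i, (atInd U (atD i) : ℝ) =
      ∑ j, ∑ s, (atInd U (atP j s) : ℝ) + ∑ j, ∑ k, (atInd U (atK j k) : ℝ)
      + ∑ s, ∑ b, (atInd U (atS s b) : ℝ) := by
    have := atInd_card m d U
    have h2 : ((U.card : ℤ) : ℝ) = _ := congrArg (fun z : ℤ => (z : ℝ)) this
    push_cast at h2
    rw [h2]; ring
  rw [hU]
  refine le_trans ?_ (at_deg m x a hx1 hcap hm _ _ _ (fun j s => atInd_nonneg U _)
    (fun s b => atInd_nonneg U _))
  unfold atCutC atCut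
  rw [Finset.sum_add_distrib, Finset.sum_add_distrib]
  refine add_le_add (add_le_add ?_ ?_) ?_
  · rw [Finset.sum_comm]; refine Finset.sum_le_sum fun j _ => ?_
    rw [Finset.sum_comm]; refine Finset.sum_le_sum fun s _ => ?_
    rw [Finset.sum_comm]; refine Finset.sum_le_sum fun b _ => ?_
    rw [← Finset.mul_sum]
    by_cases h : s ∈ T j
    · exact mul_le_mul_of_nonneg_left (hE _ _ (atG_PS T m d j s b h)) (by linarith [hx0 j s])
    · simp [hxT j s h]
  · rw [Finset.sum_comm]; refine Finset.sum_le_sum fun j _ => ?_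
    rw [Finset.sum_comm]; refine Finset.sum_le_sum fun s _ => ?_
    rw [Finset.sum_comm]; refine Finset.sum_le_sum fun k _ => ?_
    rw [← Finset.mul_sum]
    exact mul_le_mul_of_nonneg_left (hE _ _ (atG_PK T m d j s k))
      (div_nonneg (by linarith [hx1 j s]) (Nat.cast_nonneg _))
  · rw [Finset.sum_comm]; refine Finset.sum_le_sum fun s _ => ?_
    rw [← Finset.mul_sum]
    exact mul_le_mul_of_nonneg_left (hE _ _ (atG_SS T m d s)) (by linarith [ha1 s])

lemma at_sum_slot {J S : Type*} [Fintype S] (m : J → ℕ) (d : ℕ)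
    [DecidableEq (AtV J S m d)] (g : S → ℝ) (hg : ∀ s, 0 ≤ g s)
    (F : Finset (Finset (AtV J S m d)))
    (hF : ∀ C ∈ F, ∀ D ∈ F, ∀ v, v ∈ C → v ∈ D → C = D) :
    ∑ C ∈ F, ∑ s, ∑ b, (atInd C (atS s b) : ℝ) * g s ≤ ∑ s, 2 * g s := by
  rw [Finset.sum_comm]; refine Finset.sum_le_sum fun s _ => ?_
  rw [Finset.sum_comm, Fintype.sum_bool, ← Finset.sum_mul, ← Finset.sum_mul]
  nlinarith [mul_nonneg (hg s) (sub_nonneg.2 (at_sum_ind F hF (atS s true))),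
    mul_nonneg (hg s) (sub_nonneg.2 (at_sum_ind F hF (atS s false)))]

lemma atG_P {J S : Type*} (T : J → Finset S) (m : J → ℕ) (d : ℕ) (j : J) (s : S)
    (w : AtV J S m d) (h : (atG T m d).Adj (atP j s) w) :
    (∃ k, w = atK j k) ∨ (s ∈ T j ∧ ∃ b, w = atS s b) := by
  rcases w with ⟨j', s'⟩ | ⟨j', k⟩ | ⟨s', b⟩ | i
  · simp [atG, atR] at h
  · simp [atG, atR] at h
    subst h
    exact Or.inl ⟨k, rfl⟩
  · simp [atG, atR] at h
    obtain ⟨rfl, h⟩ := h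
    exact Or.inr ⟨h, b, rfl⟩
  · simp [atG, atR] at h

lemma atG_K {J S : Type*} (T : J → Finset S) (m : J → ℕ) (d : ℕ) (j : J) (k : Fin (m j))
    (w : AtV J S m d) (h : (atG T m d).Adj (atK j k) w) : ∃ s, w = atP j s := by
  rcases w with ⟨j', s'⟩ | ⟨j', k⟩ | ⟨s', b⟩ | i
  · simp [atG, atR] at h
    subst h
    exact ⟨s', rfl⟩
  · simp [atG, atR] at h
  · simp [atG, atR] at h
  · simp [atG, atR] at h

lemma atG_S {J S : Type*} (T : J → Finset S) (m : J → ℕ) (d : ℕ) (s : S) (b : Bool)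
    (w : AtV J S m d) (h : (atG T m d).Adj (atS s b) w) :
    (∃ j, w = atP j s) ∨ (∃ b', b' ≠ b ∧ w = atS s b') ∨ ∃ i, w = atD i := by
  rcases w with ⟨j', s'⟩ | ⟨j', k⟩ | ⟨s', b'⟩ | i
  · simp [atG, atR] at h
    obtain ⟨rfl, h⟩ := h
    exact Or.inl ⟨j', rfl⟩
  · simp [atG, atR] at h
  · have h1 : s = s' := by
      simp only [atG, SimpleGraph.fromRel_adj, atR] at h
      rcases h.2 with h | h
      · exact h
      · exact h.symm
    subst h1
    refine Or.inr (Or.inl ⟨b', ?_, rfl⟩)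
    rintro rfl
    exact h.ne rfl
  · exact Or.inr (Or.inr ⟨i, rfl⟩)

lemma at_sched {J S : Type*} [Fintype J] [Fintype S] [DecidableEq S]
    (T : J → Finset S) (len : J → ℕ) (m : J → ℕ) (d : ℕ)
    (hm : ∀ j, m j + len j = Fintype.card S)
    (M : (atG T m d).Subgraph) (hM : M.IsPerfectMatching) :
    ∃ A : J → Finset S, IsIntegralSchedule 2 T len A ∧ 2 * activeTime A ≤ ∑ j, len j + d := by
  classical
  rw [SimpleGraph.Subgraph.isPerfectMatching_iff] at hM
  choose mate hmate huniq using hM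
  simp only at hmate huniq
  have hadj : ∀ v, (atG T m d).Adj v (mate v) := fun v => M.adj_sub (hmate v)
  have hinv : ∀ v, mate (mate v) = v := fun v => (huniq (mate v) v (hmate v).symm).symm
  have hinj : Function.Injective mate := fun v w h => by rw [← hinv v, h, hinv]
  let A : J → Finset S := fun j => univ.filter (fun s => ∃ b, mate (atP j s) = atS s b)
  have hA : ∀ j s, s ∈ A j ↔ ∃ b, mate (atP j s) = atS s b := by intro j s; simp [A]
  have hcard : ∀ j, (A j).card = len j := by
    intro j
    choose σ hσ using fun k => atG_K T m d j k _ (hadj (atK j k))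
    have hσi : Function.Injective σ := by
      intro k k' h
      have h1 : mate (atK j k) = mate (atK j k') := by rw [hσ, hσ, h]
      have h2 := hinj h1
      simpa [atK] using h2
    have hc : (A j)ᶜ = univ.image σ := by
      ext s
      rw [Finset.mem_compl, hA, Finset.mem_image]
      constructor
      · intro h
        rcases atG_P T m d j s _ (hadj (atP j s)) with ⟨k, hk⟩ | ⟨_, hb⟩
        · refine ⟨k, Finset.mem_univ _, ?_⟩
          have h1 := hσ k
          rw [← hk, hinv] at h1
          have : s = σ k := by simpa [atP] using h1
          exact this.symm
        · exact (h hb).elim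
      · rintro ⟨k, _, rfl⟩ ⟨b, hb⟩
        rw [← hσ k, hinv] at hb
        simp [atK, atS] at hb
    have h1 := Finset.card_compl_add_card (A j)
    rw [hc, Finset.card_image_of_injective _ hσi, Finset.card_univ, Fintype.card_fin] at h1
    have := hm j
    omega
  refine ⟨A, ⟨?_, hcard, ?_⟩, ?_⟩
  · intro j s hs
    obtain ⟨b, hb⟩ := (hA j s).1 hs
    rcases atG_P T m d j s _ (hadj (atP j s)) with ⟨k, hk⟩ | ⟨h, _⟩
    · rw [hb] at hk
      simp [atK, atS] at hk
    · exact h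
  · intro s
    let jobOf : AtV J S m d → Option J := fun v => match v with
      | Sum.inl p => some p.1
      | _ => none
    have hsub : (univ.filter (fun j => s ∈ A j)).image some ⊆
        (univ : Finset Bool).image (fun b => jobOf (mate (atS s b))) := by
      intro o ho
      obtain ⟨j, hj, rfl⟩ := Finset.mem_image.1 ho
      obtain ⟨b, hb⟩ := (hA j s).1 (Finset.mem_filter.1 hj).2
      refine Finset.mem_image.2 ⟨b, Finset.mem_univ _, ?_⟩
      rw [← hb, hinv]
    have h1 := (Finset.card_le_card hsub).trans Finset.card_image_le
    rw [Finset.card_image_of_injective _ (Option.some_injective J)] at h1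
    simpa using h1
  · have hsub : ((univ.biUnion A) ×ˢ (univ : Finset Bool)).image (fun q => mate (atS q.1 q.2)) ⊆
        (univ.sigma A).image (fun p => atP p.1 p.2) ∪ (univ : Finset (Fin d)).image atD := by
      intro v hv
      obtain ⟨⟨s, b⟩, hq, rfl⟩ := Finset.mem_image.1 hv
      rw [Finset.mem_product, Finset.mem_biUnion] at hq
      obtain ⟨⟨j, _, hj⟩, _⟩ := hq
      rw [Finset.mem_union]
      rcases atG_S T m d s b _ (hadj (atS s b)) with ⟨j', h⟩ | ⟨b', hb', h⟩ | ⟨i, h⟩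
      · left
        refine Finset.mem_image.2 ⟨⟨j', s⟩, ?_, h.symm⟩
        rw [Finset.mem_sigma]
        refine ⟨Finset.mem_univ _, (hA j' s).2 ⟨b, ?_⟩⟩
        rw [← h, hinv]
      · exfalso
        obtain ⟨c, hc⟩ := (hA j s).1 hj
        have hc' : mate (atS s c) = atP j s := by rw [← hc, hinv]
        have hbb : mate (atS s b') = atS s b := by rw [← h, hinv]
        by_cases hcb : c = b
        · rw [hcb, h] at hc'
          simp [atS, atP] at hc'
        · have : c = b' := by
            revert hcb hb'
            cases b <;> cases b' <;> cases c <;> simp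
          rw [this, hbb] at hc'
          simp [atS, atP] at hc'
      · right
        exact Finset.mem_image.2 ⟨i, Finset.mem_univ _, h.symm⟩
    have hi : Function.Injective (fun q : S × Bool => mate (atS q.1 q.2 : AtV J S m d)) := by
      rintro ⟨s, b⟩ ⟨s', b'⟩ h
      have := hinj h
      simpa [atS] using this
    have h1 := (Finset.card_le_card hsub).trans (Finset.card_union_le _ _)
    rw [Finset.card_image_of_injective _ hi, Finset.card_product] at h1
    have h2 : ((univ.sigma A).image (fun p => (atP p.1 p.2 : AtV J S m d))).card ≤ ∑ j, len j := by
      refine Finset.card_image_le.trans ?_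
      rw [Finset.card_sigma]
      exact le_of_eq (Finset.sum_congr rfl fun j _ => hcard j)
    have h3 : ((univ : Finset (Fin d)).image (atD : Fin d → AtV J S m d)).card ≤ d :=
      Finset.card_image_le.trans (by simp)
    have h4 : (univ : Finset Bool).card = 2 := by simp
    rw [h4] at h1
    unfold activeTime
    omega

/-- For `B = 2`, if an integral schedule exists, then the minimum integral active
time is at most `4/3` times the minimum fractional active time: there is an integral
schedule whose active time is at most `4/3` times the active time of every
fractional schedule. -/
theorem integral_vs_fractional_active_time_B2
    {J S : Type*} [Fintype J] [Fintype S] [DecidableEq S]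
    (T : J → Finset S) (len : J → ℕ) (hlen : ∀ j, 0 < len j)
    (hex : ∃ A : J → Finset S, IsIntegralSchedule 2 T len A) :
    ∃ A : J → Finset S, IsIntegralSchedule 2 T len A ∧
      ∀ (x : J → S → ℝ) (a : S → ℝ), IsFracSchedule 2 T len x a →
        (activeTime A : ℝ) ≤ (4 / 3) * ∑ s, a s := by

  classical
  -- choose an optimal integral schedule
  have hne : ∃ n, ∃ A : J → Finset S, IsIntegralSchedule 2 T len A ∧ activeTime A = n := by
    obtain ⟨A, hA⟩ := hex
    exact ⟨_, A, hA, rfl⟩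
  obtain ⟨A, hA, hAn⟩ := Nat.find_spec hne
  have hmin : ∀ A' : J → Finset S, IsIntegralSchedule 2 T len A' → activeTime A ≤ activeTime A' := by
    intro A' hA'
    rw [hAn]
    exact Nat.find_min' hne ⟨A', hA', rfl⟩
  refine ⟨A, hA, ?_⟩
  rintro x a ⟨hx0, ha, hxT, hxs, hxa, hcap⟩
  have ha1 : ∀ s, a s ≤ 1 := fun s => (ha s).2
  have hx1 : ∀ j s, x j s ≤ 1 := fun j s => (hxa j s).trans (ha1 s)
  have hcap : ∀ s, ∑ j, x j s ≤ 2 * a s := by simpa using hcap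
  -- slack numbers
  obtain ⟨m, hm⟩ : ∃ m : J → ℕ, ∀ j, m j + len j = Fintype.card S := by
    refine ⟨fun j => Fintype.card S - len j, fun j => ?_⟩
    have : len j ≤ Fintype.card S := by
      rw [← hA.2.1 j]; exact Finset.card_le_univ _
    simp only
    omega
  have hmx : ∀ j, ∑ s, (1 - x j s) = m j := by
    intro j
    rw [Finset.sum_sub_distrib, hxs j]
    simp only [Finset.sum_const, Finset.card_univ, nsmul_eq_mul, mul_one]
    have : (m j : ℝ) + len j = Fintype.card S := by exact_mod_cast hm j
    linarith
  set P : ℕ := ∑ j, len j with hP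
  have hload : ∑ s, ∑ j, x j s = (P : ℝ) := by
    rw [Finset.sum_comm, hP]
    push_cast
    exact Finset.sum_congr rfl fun j _ => hxs j
  have hdefsum : ∑ s, (2 * a s - ∑ j, x j s) = 2 * ∑ s, a s - P := by
    rw [Finset.sum_sub_distrib, hload, ← Finset.mul_sum]
  have hdef0 : 0 ≤ 2 * ∑ s, a s - (P : ℝ) := by
    rw [← hdefsum]
    exact Finset.sum_nonneg fun s _ => by linarith [hcap s]
  have hmP : ∑ j, (m j : ℤ) + P = Fintype.card J * Fintype.card S := by
    rw [hP]
    push_cast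
    rw [← Finset.sum_add_distrib]
    have : ∀ j, (m j : ℤ) + len j = Fintype.card S := fun j => by exact_mod_cast hm j
    simp [this]
  set n := activeTime A with hn
  rcases lt_trichotomy (2 * n) (P + 1) with hlt | heq | hgt
  · have : (2 * n : ℝ) ≤ P := by exact_mod_cast Nat.lt_succ_iff.1 hlt
    have := Nat.cast_nonneg (α := ℝ) P
    linarith
  · -- one odd set
    have key := at_odd_set m x a hx0 ha1 hxa hcap hmx (fun _ _ => 1) (fun _ _ => 1)
      (fun _ _ => 1) (fun _ _ => Or.inr rfl) (fun _ _ => Or.inr rfl) (fun _ _ => Or.inr rfl) ?_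
    · have e1 : atCut m x a (fun _ _ => 1) (fun _ _ => 1) (fun _ _ => 1) = 0 := by
        simp [atCut]
      have e2 : atDef x a (fun _ _ => 1) = 2 * ∑ s, a s - P := by
        rw [← hdefsum]
        unfold atDef
        refine Finset.sum_congr rfl fun s _ => ?_
        rw [Fintype.sum_bool]; push_cast; ring
      have e3 : atLoad x (fun _ _ => 1) = P := by
        rw [← hload]
        unfold atLoad
        refine Finset.sum_congr rfl fun s _ => ?_
        rw [Fintype.sum_bool]; push_cast; ring
      rw [e1, e2, e3] at key
      have : (2 * n : ℝ) = P + 1 := by exact_mod_cast heq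
      linarith
    · simp only [Finset.sum_const, Finset.card_univ, Fintype.card_fin, mul_one,
        nsmul_eq_mul, Fintype.card_bool]
      refine ⟨Fintype.card J * Fintype.card S - n + Fintype.card S, ?_⟩
      have : (2 * n : ℤ) = P + 1 := by exact_mod_cast heq
      push_cast
      linarith
  · -- Tutte
    obtain ⟨d, hd⟩ : ∃ d, 2 * n = P + d + 2 := ⟨2 * n - P - 2, by omega⟩
    have hcardV : (Fintype.card (AtV J S m d) : ℤ) =
        Fintype.card J * Fintype.card S + ∑ j, (m j : ℤ) + 2 * Fintype.card S + d := by
      simp [AtV]; ring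
    have heven : Even (Fintype.card (AtV J S m d)) := by
      rw [← Int.even_coe_nat, hcardV]
      refine ⟨Fintype.card J * Fintype.card S + Fintype.card S + n - P - 1, ?_⟩
      have : (2 * n : ℤ) = P + d + 2 := by exact_mod_cast hd
      linarith
    have hnoM : ¬ ∃ M : (atG T m d).Subgraph, M.IsPerfectMatching := by
      rintro ⟨M, hM⟩
      obtain ⟨A', hA', h⟩ := at_sched T len m d hm M hM
      have := hmin A' hA'
      omega
    obtain ⟨U, F, hodd, hdis, hF, hcl, hUF⟩ := at_tutte (atG T m d) heven hnoM
    have hoddset : ∀ C ∈ F, (∀ i, atD i ∉ C) → 3 * (1 - (atCutC x a C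
        + atDef x a (fun s b => atInd C (atS s b)))) ≤ atLoad x (fun s b => atInd C (atS s b)) := by
      intro C hC hCd
      refine at_odd_set m x a hx0 ha1 hxa hcap hmx _ _ _ (fun _ _ => atInd_01 _ _)
        (fun _ _ => atInd_01 _ _) (fun _ _ => atInd_01 _ _) ?_
      have h1 := atInd_card m d C
      have h2 : ∑ i, atInd C (atD i) = 0 :=
        Finset.sum_eq_zero fun i _ => by simp [atInd, hCd i]
      rw [h2, add_zero] at h1
      rw [← h1]
      exact_mod_cast hodd C hC
    by_cases hall : ∀ i, atD i ∈ U
    · have hnod : ∀ C ∈ F, ∀ i, atD i ∉ C := fun C hC i hi => hdis C hC _ hi (hall i)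
      have s1 := Finset.sum_le_sum fun C hC => hoddset C hC (hnod C hC)
      rw [← Finset.mul_sum, Finset.sum_sub_distrib, Finset.sum_add_distrib] at s1
      have s2 := at_sum_cut T m d x a hx0 hxT hx1 ha1 hcap hmx U F hF hcl
      have s3 : ∑ i, (atInd U (atD i) : ℝ) = d := by
        simp [atInd, hall]
      have s4 : ∑ C ∈ F, atDef x a (fun s b => atInd C (atS s b)) ≤ 2 * ∑ s, a s - P := by
        have := at_sum_slot m d (fun s => a s - (∑ j, x j s) / 2)
          (fun s => by linarith [hcap s]) F hF
        refine this.trans (le_of_eq ?_)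
        rw [← hdefsum]
        exact Finset.sum_congr rfl fun s _ => by ring
      have s5 : ∑ C ∈ F, atLoad x (fun s b => atInd C (atS s b)) ≤ P := by
        have := at_sum_slot m d (fun s => (∑ j, x j s) / 2)
          (fun s => div_nonneg (Finset.sum_nonneg fun j _ => hx0 j s) (by norm_num)) F hF
        refine this.trans (le_of_eq ?_)
        rw [← hload]
        exact Finset.sum_congr rfl fun s _ => by ring
      rw [s3] at s2
      have s6 : ∑ C ∈ F, (1 : ℝ) = F.card := by simp
      rw [s6] at s1
      have s7 : (U.card : ℝ) + 2 ≤ F.card := by exact_mod_cast hUF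
      have s8 : (2 * n : ℝ) = P + d + 2 := by exact_mod_cast hd
      linarith
    · exfalso
      push Not at hall
      obtain ⟨i, hi⟩ := hall
      -- members without slot copies or dummies
      set F' := F.filter (fun C => atD i ∉ C) with hF'
      have hsub : F' ⊆ F := Finset.filter_subset _ _
      have hFc : F.card ≤ F'.card + 1 := by
        have h1 : F'.card + (F.filter (fun C => ¬ (atD i ∉ C))).card = F.card := by
          convert Finset.card_filter_add_card_filter_not (s := F) (fun C => atD i ∉ C)
        have h2 : (F.filter (fun C => ¬ (atD i ∉ C))).card ≤ 1 := by
          rw [Finset.card_le_one]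
          intro C hC D hD
          rw [Finset.mem_filter, not_not] at hC hD
          exact hF C hC.1 D hD.1 _ hC.2 hD.2
        omega
      have hnoS : ∀ C ∈ F', ∀ s b, atS s b ∉ C := by
        intro C hC s b hs
        rw [hF', Finset.mem_filter] at hC
        exact hC.2 (hcl C hC.1 _ hs _ (atG_SD T m d s b i) hi)
      have hnod : ∀ C ∈ F', ∀ i, atD i ∉ C := by
        intro C hC i' hs
        rw [hF', Finset.mem_filter] at hC
        by_cases h : i' = i
        · exact hC.2 (h ▸ hs)
        · exact hC.2 (hcl C hC.1 _ hs _ (atG_DD T m d i' i h) hi)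
      have s1 : ∀ C ∈ F', (1 : ℝ) ≤ atCutC x a C := by
        intro C hC
        have h1 := hoddset C (hsub hC) (hnod C hC)
        have h2 : atDef x a (fun s b => atInd C (atS s b)) = 0 := by
          simp [atDef, atInd, hnoS C hC]
        have h3 : atLoad x (fun s b => atInd C (atS s b)) = 0 := by
          simp [atLoad, atInd, hnoS C hC]
        rw [h2, h3] at h1
        linarith
      have s2 := at_sum_cut T m d x a hx0 hxT hx1 ha1 hcap hmx U F'
        (fun C hC D hD => hF C (hsub hC) D (hsub hD)) (fun C hC => hcl C (hsub hC))
      have s3 := Finset.sum_le_sum s1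
      have s4 : ∑ C ∈ F', (1 : ℝ) = F'.card := by simp
      have s5 : 0 ≤ ∑ i, (atInd U (atD i) : ℝ) := Finset.sum_nonneg fun i _ => atInd_nonneg _ _
      have s6 : (F'.card : ℝ) ≤ U.card := by linarith
      have s7 : F'.card ≤ U.card := by exact_mod_cast s6
      omega
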